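/- Sufficient condition for normality (i): with the Hartwig–Spindelböck decomposition data as in the context and Â^N := Û · fromBlocks(K*Σ₁⁻¹, 0, L*Σ₁⁻¹, 0) · Û* (the NDMPI of Â), if Â·Â*·Â^N = Â*, then Â is normal (Â·Â* = Â*·Â). -/

import Mathlib

open Matrix

/-- The dual complex numbers `𝔻ℂ := ℂ[ε]`, the trivial square-zero extension of `ℂ` by `ℂ`. -/
abbrev DC := TrivSqZeroExt ℂ ℂ

/-- Star on dual complex numbers: `(a + b·ε)* = conj a + conj b · ε`. -/
instance : Star DC :=
  ⟨fun x => ((starRingEnd ℂ) x.fst, (starRingEnd ℂ) x.snd)⟩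

/-- A positive appreciable real dual number: the standard part is a positive real and
the dual part is real. -/
def PosAppreciable (x : DC) : Prop :=
  (∃ a : ℝ, 0 < a ∧ x.fst = (a : ℂ)) ∧ (∃ b : ℝ, x.snd = (b : ℂ))

/-- A nonnegative infinitesimal real dual number: the standard part is `0` and
the dual part is a nonnegative real. -/
def NonnegInfinitesimal (x : DC) : Prop :=
  x.fst = 0 ∧ ∃ b : ℝ, 0 ≤ b ∧ x.snd = (b : ℂ)

/-- The standard part of a dual complex matrix. -/
def stdPart {m n : Type*} (X : Matrix m n DC) : Matrix m n ℂ :=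
  X.map TrivSqZeroExt.fst

/-- The dual part of a dual complex matrix. -/
def dualPart {m n : Type*} (X : Matrix m n DC) : Matrix m n ℂ :=
  X.map TrivSqZeroExt.snd

/-- The ring structure on `DC` is compatible with its star. -/
abbrev dcStarRing : StarRing DC where
  star_involutive x := by
    refine TrivSqZeroExt.ext ?_ ?_
    · exact Complex.conj_conj x.fst
    · exact Complex.conj_conj x.snd
  star_mul x y := by
    refine TrivSqZeroExt.ext ?_ ?_
    · change (starRingEnd ℂ) (x * y).fst = (starRingEnd ℂ) y.fst * (starRingEnd ℂ) x.fst
      rw [TrivSqZeroExt.fst_mul, map_mul, mul_comm]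
    · change (starRingEnd ℂ) (x * y).snd =
        (starRingEnd ℂ) y.fst * (starRingEnd ℂ) x.snd +
          (starRingEnd ℂ) y.snd * (starRingEnd ℂ) x.fst
      rw [TrivSqZeroExt.snd_mul]
      simp only [smul_eq_mul, MulOpposite.smul_eq_mul_unop, MulOpposite.unop_op, map_add, map_mul]
      ring
  star_add x y := by
    refine TrivSqZeroExt.ext ?_ ?_
    · exact map_add (starRingEnd ℂ) x.fst y.fst
    · exact map_add (starRingEnd ℂ) x.snd y.snd

theorem PosAppreciable.isUnit {x : DC} (hx : PosAppreciable x) : IsUnit x := by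
  obtain ⟨⟨a, ha, hxa⟩, -⟩ := hx
  rw [TrivSqZeroExt.isUnit_iff_isUnit_fst, hxa, isUnit_iff_ne_zero]
  exact_mod_cast ha.ne'

theorem PosAppreciable.star_eq {x : DC} (hx : PosAppreciable x) : star x = x := by
  obtain ⟨⟨a, -, ha⟩, b, hb⟩ := hx
  refine TrivSqZeroExt.ext ?_ ?_
  · change (starRingEnd ℂ) x.fst = x.fst
    rw [ha, Complex.conj_ofReal]
  · change (starRingEnd ℂ) x.snd = x.snd
    rw [hb, Complex.conj_ofReal]

theorem NonnegInfinitesimal.star_eq {x : DC} (hx : NonnegInfinitesimal x) : star x = x := by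
  obtain ⟨ha, b, -, hb⟩ := hx
  refine TrivSqZeroExt.ext ?_ ?_
  · change (starRingEnd ℂ) x.fst = x.fst
    rw [ha, map_zero]
  · change (starRingEnd ℂ) x.snd = x.snd
    rw [hb, Complex.conj_ofReal]

theorem NonnegInfinitesimal.mul_self {x : DC} (hx : NonnegInfinitesimal x) : x * x = 0 := by
  refine TrivSqZeroExt.ext ?_ ?_ <;> simp [hx.1]

/-- Over a commutative star ring, a Hartwig–Spindelböck type product with invertible Hermitian
upper block and square-zero Hermitian lower block is normal as soon as `A * Aᴴ * AN = Aᴴ`. -/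
theorem mul_conjTranspose_comm_of_hartwigSpindelbock
    {R m n : Type*} [CommRing R] [StarRing R]
    [Fintype m] [DecidableEq m] [Fintype n] [DecidableEq n]
    {U : Matrix (m ⊕ n) (m ⊕ n) R} (hU : Uᴴ * U = 1)
    {K : Matrix m m R} {L : Matrix m n R} {M : Matrix n m R} {N : Matrix n n R}
    (hW : fromBlocks K L M N * (fromBlocks K L M N)ᴴ = 1)
    {S₁ : Matrix m m R} (hS₁ : S₁ᴴ = S₁) (hS₁u : IsUnit S₁.det)
    {S₂ : Matrix n n R} (hS₂ : S₂ᴴ = S₂) (hS₂sq : S₂ * S₂ = 0)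
    {A AN : Matrix (m ⊕ n) (m ⊕ n) R}
    (hA : A = U * fromBlocks (S₁ * K) (S₁ * L) (S₂ * M) (S₂ * N) * Uᴴ)
    (hAN : AN = U * fromBlocks (Kᴴ * S₁⁻¹) 0 (Lᴴ * S₁⁻¹) 0 * Uᴴ)
    (h : A * Aᴴ * AN = Aᴴ) :
    A * Aᴴ = Aᴴ * A := by
  have hconj : ∀ X Y : Matrix (m ⊕ n) (m ⊕ n) R,
      (U * X * Uᴴ) * (U * Y * Uᴴ) = U * (X * Y) * Uᴴ := fun X Y => by
    calc (U * X * Uᴴ) * (U * Y * Uᴴ) = U * X * (Uᴴ * U) * Y * Uᴴ := by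
          simp only [Matrix.mul_assoc]
      _ = U * (X * Y) * Uᴴ := by rw [hU]; simp only [Matrix.mul_one, Matrix.mul_assoc]
  have hcancel : ∀ X Y : Matrix (m ⊕ n) (m ⊕ n) R,
      U * X * Uᴴ = U * Y * Uᴴ → X = Y := fun X Y hXY => by
    have hZ : ∀ Z : Matrix (m ⊕ n) (m ⊕ n) R, Uᴴ * (U * Z * Uᴴ) * U = Z := fun Z => by
      calc Uᴴ * (U * Z * Uᴴ) * U = (Uᴴ * U) * Z * (Uᴴ * U) := by simp only [Matrix.mul_assoc]
        _ = Z := by rw [hU, Matrix.one_mul, Matrix.mul_one]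
    rw [← hZ X, hXY, hZ Y]
  set D := fromBlocks S₁ 0 0 S₂ with hD
  set W := fromBlocks K L M N with hWdef
  have hDW : fromBlocks (S₁ * K) (S₁ * L) (S₂ * M) (S₂ * N) = D * W := by
    simp [hD, hWdef, fromBlocks_multiply]
  have hDD : D * D = fromBlocks (S₁ * S₁) 0 0 0 := by
    simp [hD, fromBlocks_multiply, hS₂sq]
  have hDstar : Dᴴ = D := by simp [hD, fromBlocks_conjTranspose, hS₁, hS₂]
  rw [hDW] at hA
  have hAstar : Aᴴ = U * (Wᴴ * D) * Uᴴ := by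
    rw [hA]
    simp only [conjTranspose_mul, conjTranspose_conjTranspose, hDstar, Matrix.mul_assoc]
  have hAA : A * Aᴴ = U * (D * D) * Uᴴ := by
    rw [hAstar, hA, hconj]
    congr 2
    calc D * W * (Wᴴ * D) = D * (W * Wᴴ) * D := by simp only [Matrix.mul_assoc]
      _ = D * D := by rw [hW, Matrix.mul_one]
  rw [hAA, hAN, hAstar, hconj] at h
  have hblocks := hcancel _ _ h
  rw [hDD, hWdef, fromBlocks_conjTranspose, hD, fromBlocks_multiply, fromBlocks_multiply] at hblocks
  simp only [Matrix.mul_zero, Matrix.zero_mul, add_zero, zero_add] at hblocks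
  obtain ⟨h₁₁, -, h₂₁, -⟩ := fromBlocks_inj.mp hblocks
  have hL : L = 0 := by
    have hLS : Lᴴ = 0 := by
      rw [← mul_nonsing_inv_cancel_right S₁ Lᴴ hS₁u, ← h₂₁, Matrix.zero_mul]
    rwa [conjTranspose_eq_zero] at hLS
  have hcomm : S₁ * S₁ * Kᴴ = Kᴴ * S₁ * S₁ := by
    rw [← h₁₁, ← Matrix.mul_assoc, nonsing_inv_mul_cancel_right S₁ _ hS₁u]
  have hKK : Kᴴ * K = 1 := by
    rw [hWdef, fromBlocks_conjTranspose, fromBlocks_multiply, ← fromBlocks_one] at hW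
    have hK := (fromBlocks_inj.mp hW).1
    rw [hL, Matrix.zero_mul, add_zero] at hK
    exact mul_eq_one_comm.mp hK
  rw [hAA, hAstar, hA, hconj]
  congr 2
  have hassoc : Wᴴ * D * (D * W) = Wᴴ * (D * D) * W := by simp only [Matrix.mul_assoc]
  rw [hassoc, hDD, hWdef, hL, fromBlocks_conjTranspose, fromBlocks_multiply, fromBlocks_multiply]
  simp only [Matrix.mul_zero, Matrix.zero_mul, add_zero, conjTranspose_zero]
  rw [← Matrix.mul_assoc Kᴴ, ← hcomm, Matrix.mul_assoc, hKK, Matrix.mul_one]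

/-- Sufficient condition for normality (i). -/
theorem normal_of_mul_conjTranspose_ndmpi
    {r s : ℕ}
    -- `Û`, a unitary matrix
    (U : Matrix (Fin r ⊕ Fin s) (Fin r ⊕ Fin s) DC)
    (hU₁ : U * Uᴴ = 1) (hU₂ : Uᴴ * U = 1)
    -- the blocks `K, L, M, N` forming a unitary block matrix
    (K : Matrix (Fin r) (Fin r) DC) (L : Matrix (Fin r) (Fin s) DC)
    (M : Matrix (Fin s) (Fin r) DC) (N : Matrix (Fin s) (Fin s) DC)
    (hW₁ : fromBlocks K L M N * (fromBlocks K L M N)ᴴ = 1)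
    (hW₂ : (fromBlocks K L M N)ᴴ * fromBlocks K L M N = 1)
    -- `Σ₁` diagonal with positive appreciable real dual diagonal entries
    (S₁ : Matrix (Fin r) (Fin r) DC) (d₁ : Fin r → DC)
    (hS₁ : S₁ = Matrix.diagonal d₁) (hd₁ : ∀ i, PosAppreciable (d₁ i))
    -- `Σ₂` diagonal with nonnegative infinitesimal real dual diagonal entries
    (S₂ : Matrix (Fin s) (Fin s) DC) (d₂ : Fin s → DC)
    (hS₂ : S₂ = Matrix.diagonal d₂) (hd₂ : ∀ i, NonnegInfinitesimal (d₂ i))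
    -- the Hartwig–Spindelböck decomposition of `Â`
    (A : Matrix (Fin r ⊕ Fin s) (Fin r ⊕ Fin s) DC)
    (hA : A = U * fromBlocks (S₁ * K) (S₁ * L) (S₂ * M) (S₂ * N) * Uᴴ)
    -- `Â^N`, the NDMPI of `Â`
    (AN : Matrix (Fin r ⊕ Fin s) (Fin r ⊕ Fin s) DC)
    (hAN : AN = U * fromBlocks (Kᴴ * S₁⁻¹) 0 (Lᴴ * S₁⁻¹) 0 * Uᴴ)
    (h : A * Aᴴ * AN = Aᴴ) :
    A * Aᴴ = Aᴴ * A := by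
  subst hS₁ hS₂
  refine @mul_conjTranspose_comm_of_hartwigSpindelbock DC _ _ _ dcStarRing _ _ _ _ U hU₂
    K L M N hW₁ _ ?_ ?_ _ ?_ ?_ A AN hA hAN h
  · exact (@diagonal_conjTranspose _ _ _ _ dcStarRing.toStarAddMonoid d₁).trans
      (congrArg diagonal (funext fun i => (hd₁ i).star_eq))
  · rw [det_diagonal, IsUnit.prod_univ_iff]
    exact fun i => (hd₁ i).isUnit
  · exact (@diagonal_conjTranspose _ _ _ _ dcStarRing.toStarAddMonoid d₂).trans
      (congrArg diagonal (funext fun i => (hd₂ i).star_eq))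
  · simp [diagonal_mul_diagonal, (hd₂ _).mul_self]
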